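/- A simple polygon Γ is not normal with respect to a finite set A ⊆ Γ if and only if there exists a sink region R in the visibility decomposition of Γ with respect to A such that the set of points of A that do not see R covers the boundary of Γ. -/

import Mathlib

open Set

noncomputable section

/-- Points of the Euclidean plane. -/
abbrev Pt : Type := EuclideanSpace ℝ (Fin 2)

/-- A simple polygon: a compact region of the plane bounded by a simple closed
polygonal curve.  Vertices are indexed by `ℤ`, periodically with period `n`. -/
structure SimplePolygon where
  carrier : Set Pt
  n : ℕ
  three_le : 3 ≤ n
  vertex : ℤ → Pt
  periodic : ∀ i : ℤ, vertex (i + n) = vertex i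
  vertex_inj : ∀ i j : ℤ, 0 ≤ i → i < n → 0 ≤ j → j < n → vertex i = vertex j → i = j
  compact : IsCompact carrier
  connected : IsConnected carrier
  regular : carrier = closure (interior carrier)
  boundary_eq : frontier carrier = ⋃ i : ℤ, segment ℝ (vertex i) (vertex (i + 1))
  adj_edges : ∀ i j : ℤ, (n : ℤ) ∣ (j - (i + 1)) → ¬ (n : ℤ) ∣ (j - i) →
    segment ℝ (vertex i) (vertex (i + 1)) ∩ segment ℝ (vertex j) (vertex (j + 1)) = {vertex j}
  nonadj_edges : ∀ i j : ℤ, ¬ (n : ℤ) ∣ (j - i) → ¬ (n : ℤ) ∣ (j - (i + 1)) →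
    ¬ (n : ℤ) ∣ (i - (j + 1)) →
    Disjoint (segment ℝ (vertex i) (vertex (i + 1))) (segment ℝ (vertex j) (vertex (j + 1)))

/-- `A`, `B` span a (maximal) boundary segment of the set `R`. -/
def IsBoundarySegment (R : Set Pt) (A B : Pt) : Prop :=
  A ≠ B ∧ segment ℝ A B ⊆ frontier R ∧
  ∀ A' B' : Pt, segment ℝ A B ⊆ segment ℝ A' B' → segment ℝ A' B' ⊆ frontier R →
    segment ℝ A' B' = segment ℝ A B

/-- `ℓ` is a support line of `R`: a line containing a boundary segment of the closure of `R`. -/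
def IsSupportLine (R : Set Pt) (ℓ : AffineSubspace ℝ Pt) : Prop :=
  ∃ A B : Pt, IsBoundarySegment (closure R) A B ∧ ℓ = affineSpan ℝ ({A, B} : Set Pt)

/-- Two regions are adjacent when they share a common boundary edge
(a nondegenerate segment). -/
def AdjacentRegions (R R' : Set Pt) : Prop :=
  R ≠ R' ∧ ∃ C D : Pt, C ≠ D ∧ segment ℝ C D ⊆ closure R ∩ closure R'

namespace SimplePolygon

variable (Γ : SimplePolygon)

/-- `G` sees `A`: the segment `GA` is contained in the polygon. -/
def Sees (G A : Pt) : Prop := segment ℝ G A ⊆ Γ.carrier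

/-- The guard set `F` (visually) covers the set `S`. -/
def Covers (F S : Set Pt) : Prop := ∀ A ∈ S, ∃ G ∈ F, Γ.Sees G A

/-- The view of a point `P`: all points of the polygon seen by `P`. -/
def View (P : Pt) : Set Pt := {A | A ∈ Γ.carrier ∧ Γ.Sees P A}

/-- The hidden region of a guard configuration `F`: points of the polygon seen by no guard. -/
def Hidden (F : Set Pt) : Set Pt := {A | A ∈ Γ.carrier ∧ ∀ G ∈ F, ¬ Γ.Sees G A}

/-- The polygon is normal: every configuration of guards covering the walls covers everything. -/
def Normal : Prop :=
  ∀ F : Set Pt, F ⊆ Γ.carrier → Γ.Covers F (frontier Γ.carrier) → Γ.Covers F Γ.carrier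

/-- The polygon is normal with respect to `A`: every configuration of guards inside `A`
covering the walls covers everything. -/
def NormalWrt (A : Set Pt) : Prop :=
  ∀ F : Set Pt, F ⊆ A → Γ.Covers F (frontier Γ.carrier) → Γ.Covers F Γ.carrier

/-- The corner at `vertex i` is reflex (interior angle exceeding 180°): points slightly
displaced from the vertex in the direction bisecting the (undirected) corner angle lie
outside the polygon. -/
def IsReflexCorner (i : ℤ) : Prop :=
  ∃ δ > (0 : ℝ), ∀ ε : ℝ, 0 < ε → ε < δ →
    Γ.vertex i + ε • ((Γ.vertex (i - 1) - Γ.vertex i) + (Γ.vertex (i + 1) - Γ.vertex i)) ∉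
      Γ.carrier

/-- The set of (indices in one period of) reflex corners of the polygon. -/
def reflexCorners : Set ℤ := {i : ℤ | 0 ≤ i ∧ i < Γ.n ∧ Γ.IsReflexCorner i}

/-- `(P, i)` is a feasible pair: `vertex i` is a reflex corner visible from `P` and the two
walls at the corner lie (weakly) on the same side of the line through `P` and `vertex i`. -/
def IsFeasible (P : Pt) (i : ℤ) : Prop :=
  Γ.IsReflexCorner i ∧ P ≠ Γ.vertex i ∧ Γ.Sees P (Γ.vertex i) ∧
  ∃ f : Pt →ₗ[ℝ] ℝ, f ≠ 0 ∧ f (Γ.vertex i - P) = 0 ∧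
    0 ≤ f (Γ.vertex (i - 1) - P) ∧ 0 ≤ f (Γ.vertex (i + 1) - P)

/-- `w` is a window of `P`: the segment from a reflex corner `C = vertex i` of a feasible
pair `(P, i)` to the farthest boundary point visible from `P` on the ray `P C` beyond `C`. -/
def IsWindow (P : Pt) (w : Set Pt) : Prop :=
  ∃ i : ℤ, ∃ W : Pt, Γ.IsFeasible P i ∧
    (∃ t : ℝ, 0 ≤ t ∧ W = Γ.vertex i + t • (Γ.vertex i - P)) ∧
    W ∈ frontier Γ.carrier ∧ Γ.Sees P W ∧
    (∀ W' : Pt, (∃ t : ℝ, 0 ≤ t ∧ W' = Γ.vertex i + t • (Γ.vertex i - P)) →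
      W' ∈ frontier Γ.carrier → Γ.Sees P W' → dist P W' ≤ dist P W) ∧
    w = segment ℝ (Γ.vertex i) W

/-- The union of all windows of points of `A`. -/
def windows (A : Set Pt) : Set Pt := ⋃₀ {w : Set Pt | ∃ P ∈ A, Γ.IsWindow P w}

/-- The (interiors of the) visibility regions of the visibility decomposition of the polygon
with respect to `A`: connected components of the interior of the polygon with all windows
removed. -/
def regionInteriors (A : Set Pt) : Set (Set Pt) :=
  {R : Set Pt | ∃ x ∈ interior Γ.carrier \ Γ.windows A,
    R = connectedComponentIn (interior Γ.carrier \ Γ.windows A) x}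

/-- `P` sees every point of `R`. -/
def SeesAll (P : Pt) (R : Set Pt) : Prop := ∀ x ∈ R, Γ.Sees P x

/-- `V(R)`: the set of points of `A` that see the (interior of the) region `R`. -/
def Vset (A R : Set Pt) : Set Pt := {P ∈ A | Γ.SeesAll P R}

/-- `R` is a sink of the visibility decomposition with respect to `A`. -/
def IsSink (A R : Set Pt) : Prop :=
  R ∈ Γ.regionInteriors A ∧
  ∀ R' ∈ Γ.regionInteriors A, AdjacentRegions R R' → Γ.Vset A R ⊆ Γ.Vset A R'

end SimplePolygon


/-! ### planar algebra -/

def crs (u v : Pt) : ℝ := u 0 * v 1 - u 1 * v 0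

theorem crs_add_left (u v w : Pt) : crs (u + v) w = crs u w + crs v w := by
  simp [crs]; ring
theorem crs_add_right (u v w : Pt) : crs u (v + w) = crs u v + crs u w := by
  simp [crs]; ring
theorem crs_sub_left (u v w : Pt) : crs (u - v) w = crs u w - crs v w := by
  simp [crs]; ring
theorem crs_sub_right (u v w : Pt) : crs u (v - w) = crs u v - crs u w := by
  simp [crs]; ring
theorem crs_smul_left (a : ℝ) (u v : Pt) : crs (a • u) v = a * crs u v := by
  simp [crs]; ring
theorem crs_smul_right (a : ℝ) (u v : Pt) : crs u (a • v) = a * crs u v := by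
  simp [crs]; ring
theorem crs_neg_left (u v : Pt) : crs (-u) v = - crs u v := by
  simp [crs]; ring
theorem crs_neg_right (u v : Pt) : crs u (-v) = - crs u v := by
  simp [crs]; ring
theorem crs_self (u : Pt) : crs u u = 0 := by
  simp [crs]; ring
theorem crs_swap (u v : Pt) : crs u v = - crs v u := by
  simp [crs]; ring

theorem crs_continuous : Continuous (fun p : Pt × Pt => crs p.1 p.2) := by
  unfold crs; fun_prop

theorem Continuous.crs' {X : Type*} [TopologicalSpace X] {f g : X → Pt}
    (hf : Continuous f) (hg : Continuous g) : Continuous (fun x => crs (f x) (g x)) :=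
  crs_continuous.comp (hf.prodMk hg)

def crsL (u : Pt) : Pt →ₗ[ℝ] ℝ where
  toFun v := crs u v
  map_add' v w := crs_add_right u v w
  map_smul' a v := by simp [crs_smul_right]

theorem crsL_apply (u v : Pt) : crsL u v = crs u v := rfl

theorem exists_crs_ne {u : Pt} (hu : u ≠ 0) : ∃ v, crs u v ≠ 0 := by
  by_contra! h
  apply hu
  have h1 := h !₂[0, 1]
  have h2 := h !₂[1, 0]
  simp [crs] at h1 h2
  ext i; fin_cases i <;> simp [h1, h2]

theorem par {u w : Pt} (hu : u ≠ 0) (h : crs u w = 0) : ∃ r : ℝ, w = r • u := by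
  unfold crs at h
  by_cases h0 : u 0 = 0
  · have h1 : u 1 ≠ 0 := by
      intro h1; apply hu; ext i; fin_cases i <;> simp [h0, h1]
    refine ⟨w 1 / u 1, ?_⟩
    have : w 0 = 0 := by
      rw [h0] at h
      have : u 1 * w 0 = 0 := by linarith
      rcases mul_eq_zero.1 this with h | h
      · exact absurd h h1
      · exact h
    ext i; fin_cases i
    · simp [h0, this]
    · simp; field_simp
  · refine ⟨w 0 / u 0, ?_⟩
    ext i; fin_cases i
    · simp; field_simp
    · simp; field_simp; linarith

theorem collinear_of_crs {x y z : Pt} (hxy : x ≠ y) (h : crs (y - x) (z - x) = 0) :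
    Collinear ℝ ({x, y, z} : Set Pt) := by
  obtain ⟨r, hr⟩ := par (sub_ne_zero.2 hxy.symm) h
  rw [collinear_iff_of_mem (p₀ := x) (by simp)]
  refine ⟨y - x, ?_⟩
  intro p hp
  simp only [mem_insert_iff, mem_singleton_iff] at hp
  rcases hp with rfl | rfl | rfl
  · exact ⟨0, by simp⟩
  · exact ⟨1, by simp⟩
  · exact ⟨r, by rw [← hr]; simp⟩

/-- two linear conditions force zero -/
theorem eq_zero_of_crs {e1 e2 u : Pt} (hD : crs e1 e2 ≠ 0) (h1 : crs u e2 = 0)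
    (h2 : crs e1 u = 0) : u = 0 := by
  have he1 : e1 ≠ 0 := by
    rintro rfl; apply hD; simp [crs]
  obtain ⟨r, rfl⟩ := par he1 h2
  rw [crs_smul_left] at h1
  rcases mul_eq_zero.1 h1 with h | h
  · simp [h]
  · exact absurd h hD

theorem line_compl_dense {d : Pt} (hd : d ≠ 0) (X : Pt) :
    Dense {y : Pt | crs d (y - X) = 0}ᶜ := by
  obtain ⟨v, hv⟩ := exists_crs_ne hd
  intro y
  by_cases hy : crs d (y - X) = 0
  · have ht : Filter.Tendsto (fun t : ℝ => y + t • v) (nhdsWithin 0 (Ioi 0)) (nhds y) := by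
      have : Continuous (fun t : ℝ => y + t • v) := by fun_prop
      have h2 := this.tendsto 0
      simp only [zero_smul, add_zero] at h2
      exact h2.mono_left nhdsWithin_le_nhds
    refine mem_closure_of_tendsto ht ?_
    filter_upwards [self_mem_nhdsWithin] with t ht
    have ht : 0 < t := ht
    show ¬ (crs d (y + t • v - X) = 0)
    rw [show y + t • v - X = (y - X) + t • v by abel, crs_add_right, hy, crs_smul_right, zero_add]
    exact mul_ne_zero ht.ne' hv
  · exact subset_closure hy

theorem line_closed (d : Pt) (X : Pt) : IsClosed {y : Pt | crs d (y - X) = 0} :=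
  isClosed_eq (Continuous.crs' continuous_const (by fun_prop)) continuous_const

theorem segment_subset_line (a b : Pt) {d X : Pt} (ha : crs d (a - X) = 0)
    (hb : crs d (b - X) = 0) {y : Pt} (hy : y ∈ segment ℝ a b) : crs d (y - X) = 0 := by
  rw [segment_eq_image'] at hy
  obtain ⟨t, -, rfl⟩ := hy
  have : a + t • (b - a) - X = (a - X) + t • ((b - X) - (a - X)) := by
    rw [sub_sub_sub_cancel_right]; abel
  simp only [this]
  rw [crs_add_right, crs_smul_right, crs_sub_right d (b - X), ha, hb]; ring

theorem segment_compl_dense (a b : Pt) : Dense (segment ℝ a b)ᶜ := by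
  by_cases h : a = b
  · obtain ⟨d, hd⟩ : ∃ d : Pt, d ≠ 0 := exists_ne 0
    refine (line_compl_dense hd a).mono ?_
    apply compl_subset_compl.2
    intro y hy
    exact segment_subset_line a b (by simp [crs]) (by simp [h, crs]) hy
  · refine (line_compl_dense (sub_ne_zero.2 (Ne.symm h)) a).mono ?_
    apply compl_subset_compl.2
    intro y hy
    exact segment_subset_line a b (by simp [crs]) (crs_self _) hy

theorem segment_closed (a b : Pt) : IsClosed (segment ℝ a b) := by
  rw [segment_eq_image']
  exact (isCompact_Icc.image (by fun_prop)).isClosed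

/-! ### dichotomy near a boundary point -/

theorem preconn_dich {K S : Set Pt} (hK : IsClosed K) (hS : IsPreconnected S)
    (h : ∀ y ∈ S, y ∉ frontier K) : S ⊆ interior K ∨ S ⊆ Kᶜ := by
  have hsub : S ⊆ interior K ∪ Kᶜ := by
    intro y hy
    by_cases hyK : y ∈ K
    · left
      by_contra hn
      exact h y hy (by rw [hK.frontier_eq]; exact ⟨hyK, hn⟩)
    · right; exact hyK
  exact hS.subset_or_subset isOpen_interior hK.isOpen_compl
    (disjoint_compl_right.mono_left interior_subset) hsub

theorem reg_dich {K S1 S2 L U : Set Pt} {p : Pt} (hK : IsClosed K) (hreg : K = closure (interior K))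
    (hp : p ∈ frontier K) (hU : IsOpen U) (hpU : p ∈ U) (hL : Dense Lᶜ)
    (hS1 : IsPreconnected S1) (hS2 : IsPreconnected S2) (hUL : U \ L ⊆ S1 ∪ S2)
    (h1 : ∀ y ∈ S1, y ∉ frontier K) (h2 : ∀ y ∈ S2, y ∉ frontier K) :
    (S1 ⊆ interior K ∧ S2 ⊆ Kᶜ) ∨ (S1 ⊆ Kᶜ ∧ S2 ⊆ interior K) := by
  have hpK : p ∈ K := hK.frontier_subset hp
  have hpi : p ∉ interior K := by
    rw [hK.frontier_eq] at hp; exact hp.2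
  have hcl : U ⊆ closure (U \ L) := by
    have := hL.open_subset_closure_inter hU
    exact this
  rcases preconn_dich hK hS1 h1 with a | a <;> rcases preconn_dich hK hS2 h2 with b | b
  · exfalso
    apply hpi
    refine mem_interior.2 ⟨U, ?_, hU, hpU⟩
    refine hcl.trans (closure_minimal ?_ hK)
    exact hUL.trans (union_subset (a.trans interior_subset) (b.trans interior_subset))
  · exact Or.inl ⟨a, b⟩
  · exact Or.inr ⟨a, b⟩
  · exfalso
    rw [hreg] at hpK
    obtain ⟨y, hyU, hyi⟩ := mem_closure_iff.1 hpK U hU hpU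
    obtain ⟨z, hz, hzi⟩ := mem_closure_iff.1 (hcl hyU) (interior K) isOpen_interior hyi
    rcases hUL hzi with h | h
    · exact a h (interior_subset hz)
    · exact b h (interior_subset hz)

namespace SimplePolygon

variable (Γ : SimplePolygon)

theorem closed : IsClosed Γ.carrier := Γ.compact.isClosed

theorem vertex_congr {i j : ℤ} (h : (Γ.n : ℤ) ∣ j - i) : Γ.vertex i = Γ.vertex j := by
  obtain ⟨k, hk⟩ := h
  have hp : Function.Periodic Γ.vertex (Γ.n : ℤ) := Γ.periodic
  have := hp.int_mul k i
  rw [← this]; congr 1; simp; linarith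

theorem n_pos : (0 : ℤ) < Γ.n := by have := Γ.three_le; omega

theorem vertex_emod (i : ℤ) : Γ.vertex (i % Γ.n) = Γ.vertex i := by
  apply Γ.vertex_congr
  exact Int.dvd_self_sub_emod

theorem vertex_emod_succ (i : ℤ) : Γ.vertex (i % Γ.n + 1) = Γ.vertex (i + 1) := by
  apply Γ.vertex_congr
  have : i + 1 - (i % Γ.n + 1) = i - i % Γ.n := by ring
  rw [this]
  exact Int.dvd_self_sub_emod

theorem dvd_of_vertex_eq {i j : ℤ} (h : Γ.vertex i = Γ.vertex j) : (Γ.n : ℤ) ∣ j - i := by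
  have hn := Γ.n_pos
  have := Γ.vertex_inj (i % Γ.n) (j % Γ.n) (Int.emod_nonneg _ hn.ne') (Int.emod_lt_of_pos _ hn)
    (Int.emod_nonneg _ hn.ne') (Int.emod_lt_of_pos _ hn)
    (by rw [vertex_emod, vertex_emod, h])
  exact Int.ModEq.dvd this

def edge (i : ℤ) : Set Pt := segment ℝ (Γ.vertex i) (Γ.vertex (i + 1))

theorem mem_frontier_iff (y : Pt) : y ∈ frontier Γ.carrier ↔ ∃ i, y ∈ Γ.edge i := by
  rw [Γ.boundary_eq]; simp [edge]

theorem edge_emod (i : ℤ) : Γ.edge (i % Γ.n) = Γ.edge i := by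
  unfold edge; rw [vertex_emod, vertex_emod_succ]

theorem emod_mem (i : ℤ) : i % Γ.n ∈ Set.Ico (0 : ℤ) Γ.n :=
  ⟨Int.emod_nonneg _ Γ.n_pos.ne', Int.emod_lt_of_pos _ Γ.n_pos⟩

theorem vertices_finite : (Set.range Γ.vertex).Finite := by
  refine ((Set.finite_Ico (0 : ℤ) Γ.n).image Γ.vertex).subset ?_
  rintro _ ⟨i, rfl⟩
  exact ⟨i % Γ.n, Γ.emod_mem i, Γ.vertex_emod i⟩

theorem edges_finite : (Set.range Γ.edge).Finite := by
  refine ((Set.finite_Ico (0 : ℤ) Γ.n).image Γ.edge).subset ?_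
  rintro _ ⟨i, rfl⟩
  exact ⟨i % Γ.n, Γ.emod_mem i, Γ.edge_emod i⟩

theorem finite_closed_avoid {F : Set (Set Pt)} (hF : F.Finite) (hc : ∀ s ∈ F, IsClosed s) (X : Pt) :
    ∀ᶠ y in nhds X, ∀ s ∈ F, y ∈ s → X ∈ s := by
  rw [Filter.eventually_all_finite hF]
  intro s hs
  by_cases hX : X ∈ s
  · exact Filter.Eventually.of_forall fun _ _ => hX
  · filter_upwards [(hc s hs).isOpen_compl.mem_nhds hX] with y hy h
    exact absurd h hy

theorem edges_avoid (X : Pt) : ∃ r > 0, ∀ y ∈ Metric.ball X r, ∀ i, y ∈ Γ.edge i → X ∈ Γ.edge i := by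
  have := finite_closed_avoid Γ.edges_finite (by rintro _ ⟨i, rfl⟩; exact segment_closed _ _) X
  obtain ⟨r, hr, h⟩ := Metric.eventually_nhds_iff_ball.1 this
  exact ⟨r, hr, fun y hy i hi => h y hy _ ⟨i, rfl⟩ hi⟩

theorem vertex_mem_frontier (i : ℤ) : Γ.vertex i ∈ frontier Γ.carrier :=
  (Γ.mem_frontier_iff _).2 ⟨i, left_mem_segment _ _ _⟩

theorem edge_congr {i j : ℤ} (h : (Γ.n : ℤ) ∣ j - i) : Γ.edge i = Γ.edge j := by
  unfold edge
  rw [Γ.vertex_congr h, Γ.vertex_congr (i := i + 1) (j := j + 1) (by simpa using h)]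

theorem edge_unique {X : Pt} {i j : ℤ} (hi : X ∈ Γ.edge i) (hj : X ∈ Γ.edge j)
    (hX : ∀ k, X ≠ Γ.vertex k) : Γ.edge j = Γ.edge i := by
  by_cases h : (Γ.n : ℤ) ∣ j - i
  · exact (Γ.edge_congr h).symm
  exfalso
  by_cases h1 : (Γ.n : ℤ) ∣ j - (i + 1)
  · have := Γ.adj_edges i j h1 h
    exact hX j (this.subset ⟨hi, hj⟩)
  by_cases h2 : (Γ.n : ℤ) ∣ i - (j + 1)
  · have := Γ.adj_edges j i h2 (by rwa [dvd_sub_comm])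
    exact hX i (this.subset ⟨hj, hi⟩)
  exact Set.disjoint_left.1 (Γ.nonadj_edges i j h h1 h2) hi hj

theorem edge_at_vertex {i j : ℤ} (hj : Γ.vertex i ∈ Γ.edge j) :
    Γ.edge j = Γ.edge i ∨ Γ.edge j = Γ.edge (i - 1) := by
  by_cases h : (Γ.n : ℤ) ∣ j - i
  · exact Or.inl (Γ.edge_congr h).symm
  by_cases h2 : (Γ.n : ℤ) ∣ i - (j + 1)
  · right; exact Γ.edge_congr (by rwa [show i - 1 - j = i - (j + 1) by ring])
  exfalso
  have hi : Γ.vertex i ∈ Γ.edge i := left_mem_segment _ _ _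
  by_cases h1 : (Γ.n : ℤ) ∣ j - (i + 1)
  · have := Γ.adj_edges i j h1 h
    exact h (Γ.dvd_of_vertex_eq (this.subset ⟨hi, hj⟩))
  exact Set.disjoint_left.1 (Γ.nonadj_edges i j h h1 h2) hi hj

theorem convex_half (d X : Pt) (r : ℝ) :
    Convex ℝ {y : Pt | y ∈ Metric.ball X r ∧ 0 < crs d (y - X)} := by
  have h1 : Convex ℝ {y : Pt | 0 < crs d (y - X)} := by
    have := convex_halfSpace_gt (crsL d).isLinear (crs d X)
    have e : {y : Pt | 0 < crs d (y - X)} = {w | crs d X < (crsL d) w} := by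
      ext y
      show 0 < crs d (y - X) ↔ crs d X < crs d y
      rw [crs_sub_right, sub_pos]
    rw [e]; exact this
  exact (convex_ball X r).inter h1

/-- local structure at a non-vertex boundary point -/
theorem edge_local {X d : Pt} {i : ℤ} (hX : X ∈ Γ.edge i) (hXv : ∀ k, X ≠ Γ.vertex k)
    (hd : d ≠ 0) (h1 : crs d (Γ.vertex i - X) = 0) (h2 : crs d (Γ.vertex (i + 1) - X) = 0) :
    ∃ r > 0, ∃ s : ℝ, s ≠ 0 ∧
      (∀ y ∈ Metric.ball X r, 0 < s * crs d (y - X) → y ∈ interior Γ.carrier) ∧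
      (∀ y ∈ Metric.ball X r, s * crs d (y - X) < 0 → y ∉ Γ.carrier) := by
  obtain ⟨r, hr, hav⟩ := Γ.edges_avoid X
  have hfr : ∀ y ∈ Metric.ball X r, y ∈ frontier Γ.carrier → crs d (y - X) = 0 := by
    intro y hy hyf
    obtain ⟨j, hj⟩ := (Γ.mem_frontier_iff y).1 hyf
    have hXj := hav y hy j hj
    rw [Γ.edge_unique hX hXj hXv] at hj
    exact segment_subset_line _ _ h1 h2 hj
  have := reg_dich (K := Γ.carrier) (p := X) (U := Metric.ball X r)
    (L := {y | crs d (y - X) = 0})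
    (S1 := {y : Pt | y ∈ Metric.ball X r ∧ 0 < crs d (y - X)})
    (S2 := {y : Pt | y ∈ Metric.ball X r ∧ 0 < crs (-d) (y - X)}) Γ.closed Γ.regular
    ((Γ.mem_frontier_iff X).2 ⟨i, hX⟩) Metric.isOpen_ball (Metric.mem_ball_self hr)
    (line_compl_dense hd X) (convex_half d X r).isPreconnected (convex_half (-d) X r).isPreconnected
    (by
      rintro y ⟨hy, hy2⟩
      have hy2 : crs d (y - X) ≠ 0 := hy2
      rcases lt_or_gt_of_ne hy2 with h | h
      · right; exact ⟨hy, by rw [crs_neg_left]; linarith⟩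
      · left; exact ⟨hy, h⟩)
    (by rintro y ⟨hy, h⟩ hf; exact h.ne' (hfr y hy hf))
    (by rintro y ⟨hy, h⟩ hf; rw [crs_neg_left, hfr y hy hf] at h; simp at h)
  rcases this with ⟨ha, hb⟩ | ⟨ha, hb⟩
  · refine ⟨r, hr, 1, one_ne_zero, ?_, ?_⟩
    · intro y hy h; exact ha ⟨hy, by linarith⟩
    · intro y hy h; exact hb ⟨hy, by rw [crs_neg_left]; linarith⟩
  · refine ⟨r, hr, -1, by norm_num, ?_, ?_⟩
    · intro y hy h; exact hb ⟨hy, by rw [crs_neg_left]; linarith⟩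
    · intro y hy h; exact ha ⟨hy, by linarith⟩

def e1 (i : ℤ) : Pt := Γ.vertex (i - 1) - Γ.vertex i
def e2 (i : ℤ) : Pt := Γ.vertex (i + 1) - Γ.vertex i

/-- local structure at a vertex -/
theorem vertex_local {i : ℤ} (hD : crs (Γ.e1 i) (Γ.e2 i) ≠ 0) :
    ∃ r > 0,
      ((∀ y ∈ Metric.ball (Γ.vertex i) r,
          0 < crs (y - Γ.vertex i) (Γ.e2 i) * crs (Γ.e1 i) (Γ.e2 i) →
          0 < crs (Γ.e1 i) (y - Γ.vertex i) * crs (Γ.e1 i) (Γ.e2 i) → y ∈ interior Γ.carrier) ∧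
       (∀ y ∈ Metric.ball (Γ.vertex i) r,
          (crs (y - Γ.vertex i) (Γ.e2 i) * crs (Γ.e1 i) (Γ.e2 i) < 0 ∨
          crs (Γ.e1 i) (y - Γ.vertex i) * crs (Γ.e1 i) (Γ.e2 i) < 0) → y ∉ Γ.carrier)) ∨
      ((∀ y ∈ Metric.ball (Γ.vertex i) r,
          0 < crs (y - Γ.vertex i) (Γ.e2 i) * crs (Γ.e1 i) (Γ.e2 i) →
          0 < crs (Γ.e1 i) (y - Γ.vertex i) * crs (Γ.e1 i) (Γ.e2 i) → y ∉ Γ.carrier) ∧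
       (∀ y ∈ Metric.ball (Γ.vertex i) r,
          (crs (y - Γ.vertex i) (Γ.e2 i) * crs (Γ.e1 i) (Γ.e2 i) < 0 ∨
          crs (Γ.e1 i) (y - Γ.vertex i) * crs (Γ.e1 i) (Γ.e2 i) < 0) →
            y ∈ interior Γ.carrier)) := by
  obtain ⟨r, hr, hav⟩ := Γ.edges_avoid (Γ.vertex i)
  set C := Γ.vertex i with hC
  set E1 := Γ.e1 i with hE1
  set E2 := Γ.e2 i with hE2
  set D := crs E1 E2 with hDd
  have hD2 : 0 < D * D := mul_self_pos.2 hD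
  have hE1' : E1 ≠ 0 := by intro h; apply hD; rw [hDd, h]; simp [crs]
  have hE2' : E2 ≠ 0 := by intro h; apply hD; rw [hDd, h]; simp [crs]
  -- functionals as `crs d`
  have ha : ∀ y, crs y E2 * D = crs ((-D) • E2) y := by
    intro y; rw [crs_smul_left, crs_swap E2]; ring
  have hb : ∀ y, crs E1 y * D = crs (D • E1) y := by
    intro y; rw [crs_smul_left]; ring
  have hfr : ∀ y ∈ Metric.ball C r, y ∈ frontier Γ.carrier →
      (∃ t : ℝ, 0 ≤ t ∧ y - C = t • E2) ∨ (∃ t : ℝ, 0 ≤ t ∧ y - C = t • E1) := by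
    intro y hy hyf
    obtain ⟨j, hj⟩ := (Γ.mem_frontier_iff y).1 hyf
    have hXj := hav y hy j hj
    rcases Γ.edge_at_vertex hXj with h | h
    · rw [h, edge, segment_eq_image'] at hj
      obtain ⟨t, ht, rfl⟩ := hj
      left; exact ⟨t, ht.1, by simp [hE2, hC, e2]⟩
    · rw [h, edge, segment_symm, segment_eq_image', sub_add_cancel] at hj
      obtain ⟨t, ht, rfl⟩ := hj
      right; exact ⟨t, ht.1, by simp [hE1, hC, e1]⟩
  have hS2 : IsPreconnected {y : Pt | y ∈ Metric.ball C r ∧ (crs (y - C) E2 * D < 0 ∨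
      crs E1 (y - C) * D < 0)} := by
    have e : {y : Pt | y ∈ Metric.ball C r ∧ (crs (y - C) E2 * D < 0 ∨
      crs E1 (y - C) * D < 0)} = {y : Pt | y ∈ Metric.ball C r ∧ 0 < crs (D • E2) (y - C)} ∪
        {y : Pt | y ∈ Metric.ball C r ∧ 0 < crs (-D • E1) (y - C)} := by
      ext y
      have h1 : crs (y - C) E2 * D < 0 ↔ 0 < crs (D • E2) (y - C) := by
        rw [crs_smul_left, crs_swap E2]; constructor <;> intro h <;> linarith
      have h2 : crs E1 (y - C) * D < 0 ↔ 0 < crs (-D • E1) (y - C) := by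
        rw [crs_smul_left]; constructor <;> intro h <;> linarith
      simp only [Set.mem_union]
      show (_ ∧ _) ↔ (_ ∧ _) ∨ (_ ∧ _)
      rw [h1, h2, and_or_left]
    rw [e]
    have hpos : 0 < r / (2 * (‖E1 + E2‖ + 1)) := by positivity
    set ε := r / (2 * (‖E1 + E2‖ + 1)) with hε
    have hball : C + (-ε) • (E1 + E2) ∈ Metric.ball C r := by
      rw [mem_ball_iff_norm, add_sub_cancel_left, norm_smul, norm_neg, Real.norm_of_nonneg hpos.le,
        hε, div_mul_eq_mul_div, div_lt_iff₀ (by positivity)]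
      nlinarith [norm_nonneg (E1 + E2)]
    refine IsPreconnected.union (C + (-ε) • (E1 + E2)) ⟨hball, ?_⟩ ⟨hball, ?_⟩
      (convex_half _ _ _).isPreconnected (convex_half _ _ _).isPreconnected
    · rw [add_sub_cancel_left, crs_smul_left, crs_smul_right, crs_add_right, crs_self,
        crs_swap E2 E1, ← hDd]
      nlinarith
    · rw [add_sub_cancel_left, crs_smul_left, crs_smul_right, crs_add_right, crs_self, ← hDd]
      nlinarith
  have hS1 : IsPreconnected {y : Pt | y ∈ Metric.ball C r ∧ 0 < crs (y - C) E2 * D ∧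
      0 < crs E1 (y - C) * D} := by
    have e : {y : Pt | y ∈ Metric.ball C r ∧ 0 < crs (y - C) E2 * D ∧
      0 < crs E1 (y - C) * D} = {y : Pt | y ∈ Metric.ball C r ∧ 0 < crs (-D • E2) (y - C)} ∩
        {y : Pt | y ∈ Metric.ball C r ∧ 0 < crs (D • E1) (y - C)} := by
      ext y
      simp only [Set.mem_inter_iff]
      show (_ ∧ _ ∧ _) ↔ (_ ∧ _) ∧ (_ ∧ _)
      rw [ha, hb]; tauto
    rw [e]
    exact ((convex_half _ _ _).inter (convex_half _ _ _)).isPreconnected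
  have := reg_dich (K := Γ.carrier) (p := C) (U := Metric.ball C r)
    (L := {y | crs E2 (y - C) = 0} ∪ {y | crs E1 (y - C) = 0}) Γ.closed Γ.regular
    (Γ.vertex_mem_frontier i) Metric.isOpen_ball (Metric.mem_ball_self hr)
    (by
      rw [Set.compl_union]
      exact (line_compl_dense hE2' C).inter_of_isOpen_left (line_compl_dense hE1' C)
        (line_closed _ _).isOpen_compl) hS1 hS2
    (by
      rintro y ⟨hy, hy2⟩
      have h1 : crs (y - C) E2 * D ≠ 0 := by
        intro h
        apply hy2; left
        show crs E2 (y - C) = 0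
        rw [crs_swap, neg_eq_zero]
        exact (mul_eq_zero.1 h).resolve_right hD
      have h2 : crs E1 (y - C) * D ≠ 0 := by
        intro h
        apply hy2; right
        exact (mul_eq_zero.1 h).resolve_right hD
      rcases lt_or_gt_of_ne h1 with h | h
      · right; exact ⟨hy, Or.inl h⟩
      rcases lt_or_gt_of_ne h2 with h' | h'
      · right; exact ⟨hy, Or.inr h'⟩
      · left; exact ⟨hy, h, h'⟩)
    (by
      rintro y ⟨hy, h, h'⟩ hf
      rcases hfr y hy hf with ⟨t, ht, hy⟩ | ⟨t, ht, hy⟩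
      · rw [hy, crs_smul_left, crs_self] at h; simp at h
      · rw [hy, crs_smul_right, crs_self] at h'; simp at h')
    (by
      rintro y ⟨hy, h⟩ hf
      rcases hfr y hy hf with ⟨t, ht, hy⟩ | ⟨t, ht, hy⟩
      · rw [hy, crs_smul_left, crs_self, crs_smul_right, ← hDd] at h
        rcases h with h | h
        · simp at h
        · nlinarith
      · rw [hy, crs_smul_left, crs_smul_right, crs_self, ← hDd] at h
        rcases h with h | h
        · nlinarith
        · simp at h)
  refine ⟨r, hr, ?_⟩
  rcases this with ⟨h, h'⟩ | ⟨h, h'⟩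
  · left; exact ⟨fun y hy h1 h2 => h ⟨hy, h1, h2⟩, fun y hy h1 => h' ⟨hy, h1⟩⟩
  · right; exact ⟨fun y hy h1 h2 => h ⟨hy, h1, h2⟩, fun y hy h1 => h' ⟨hy, h1⟩⟩

def GP (A : Set Pt) : Prop := ∀ x y z : Pt,
      x ∈ (Γ.vertex '' Set.univ) ∪ A → y ∈ (Γ.vertex '' Set.univ) ∪ A →
      z ∈ (Γ.vertex '' Set.univ) ∪ A → x ≠ y → x ≠ z → y ≠ z →
      ¬ Collinear ℝ ({x, y, z} : Set Pt)

variable {Γ}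

theorem vmem (A : Set Pt) (i : ℤ) : Γ.vertex i ∈ (Γ.vertex '' Set.univ) ∪ A :=
  Or.inl ⟨i, trivial, rfl⟩

theorem GP.crs {A : Set Pt} (h : Γ.GP A) {x y z : Pt}
    (hx : x ∈ (Γ.vertex '' Set.univ) ∪ A) (hy : y ∈ (Γ.vertex '' Set.univ) ∪ A)
    (hz : z ∈ (Γ.vertex '' Set.univ) ∪ A) (hxy : x ≠ y) (hxz : x ≠ z) (hyz : y ≠ z) :
    crs (y - x) (z - x) ≠ 0 :=
  fun h0 => h x y z hx hy hz hxy hxz hyz (collinear_of_crs hxy h0)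

theorem vertex_ne_succ (i : ℤ) : Γ.vertex i ≠ Γ.vertex (i + 1) := by
  intro h
  have := Γ.dvd_of_vertex_eq h
  have := Int.le_of_dvd (by omega) this
  have := Γ.three_le
  omega

theorem vertex_ne_pred (i : ℤ) : Γ.vertex i ≠ Γ.vertex (i - 1) := by
  have := vertex_ne_succ (Γ := Γ) (i - 1)
  rw [sub_add_cancel] at this
  exact this.symm

theorem vertex_pred_ne_succ (i : ℤ) : Γ.vertex (i - 1) ≠ Γ.vertex (i + 1) := by
  intro h
  have := Γ.dvd_of_vertex_eq h
  have := Int.le_of_dvd (by omega) this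
  have := Γ.three_le
  omega

theorem GP.D {A : Set Pt} (h : Γ.GP A) (i : ℤ) : _root_.crs (Γ.e1 i) (Γ.e2 i) ≠ 0 :=
  h.crs (vmem A i) (vmem A _) (vmem A _) (vertex_ne_pred i) (vertex_ne_succ i)
    (vertex_pred_ne_succ i)

theorem sees_iff (P Q : Pt) :
    Γ.Sees P Q ↔ ∀ t : ℝ, 0 ≤ t → t ≤ 1 → P + t • (Q - P) ∈ Γ.carrier := by
  unfold Sees
  rw [segment_eq_image']
  constructor
  · intro h t h0 h1; exact h ⟨t, ⟨h0, h1⟩, rfl⟩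
  · rintro h _ ⟨t, ht, rfl⟩; exact h t ht.1 ht.2

theorem sees_ray {P C : Pt} {t : ℝ} (ht : -1 < t) :
    Γ.Sees P (C + t • (C - P)) ↔ ∀ l : ℝ, -1 ≤ l → l ≤ t → C + l • (C - P) ∈ Γ.carrier := by
  rw [sees_iff]
  have h0 : 0 < 1 + t := by linarith
  constructor
  · intro h l h1 h2
    have := h ((1 + l) / (1 + t)) (div_nonneg (by linarith) h0.le)
      ((div_le_one h0).2 (by linarith))
    convert this using 1
    have e : C + t • (C - P) - P = (1 + t) • (C - P) := by module
    rw [e, smul_smul, div_mul_cancel₀ _ h0.ne']; module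
  · intro h s h1 h2
    have := h (s * (1 + t) - 1) (by nlinarith) (by nlinarith)
    convert this using 1
    module

theorem view_closed (P : Pt) : IsClosed {Q | Γ.Sees P Q} := by
  have : {Q | Γ.Sees P Q} = ⋂ t ∈ Set.Icc (0 : ℝ) 1, {Q | P + t • (Q - P) ∈ Γ.carrier} := by
    ext Q
    simp only [mem_iInter]
    show Γ.Sees P Q ↔ ∀ t ∈ Set.Icc (0 : ℝ) 1, P + t • (Q - P) ∈ Γ.carrier
    rw [sees_iff]
    exact ⟨fun h t ht => h t ht.1 ht.2, fun h t h0 h1 => h t ⟨h0, h1⟩⟩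
  rw [this]
  refine isClosed_biInter fun t _ => ?_
  exact Γ.closed.preimage (f := fun Q => P + t • (Q - P)) (by fun_prop)

theorem not_interior {x : Pt} (hx : x ∈ frontier Γ.carrier) : x ∉ interior Γ.carrier := by
  rw [Γ.closed.frontier_eq] at hx; exact hx.2

theorem mem_of_interior {x : Pt} (hx : x ∈ interior Γ.carrier) : x ∈ Γ.carrier :=
  interior_subset hx

theorem small_ball (C u : Pt) {r : ℝ} (hr : 0 < r) :
    ∃ δ > 0, ∀ ε : ℝ, |ε| < δ → C + ε • u ∈ Metric.ball C r := by
  refine ⟨r / (‖u‖ + 1), by positivity, fun ε hε => ?_⟩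
  rw [mem_ball_iff_norm, add_sub_cancel_left, norm_smul, Real.norm_eq_abs]
  rw [lt_div_iff₀ (by positivity)] at hε
  nlinarith [norm_nonneg u, abs_nonneg ε]

/-- existence of the farthest visible boundary point -/
theorem exists_far {P C Q : Pt} (hPC : P ≠ C) {s : ℝ} (hs : 0 ≤ s) (hQ : Q = C + s • (C - P))
    (hsee : Γ.Sees P Q) :
    ∃ W, (∃ t : ℝ, 0 ≤ t ∧ W = C + t • (C - P)) ∧ W ∈ frontier Γ.carrier ∧ Γ.Sees P W ∧
    (∀ W' : Pt, (∃ t : ℝ, 0 ≤ t ∧ W' = C + t • (C - P)) →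
      W' ∈ frontier Γ.carrier → Γ.Sees P W' → dist P W' ≤ dist P W) ∧ Q ∈ segment ℝ C W := by
  have hn : 0 < ‖C - P‖ := norm_pos_iff.2 (sub_ne_zero.2 hPC.symm)
  set T : Set ℝ := {t | 0 ≤ t ∧ Γ.Sees P (C + t • (C - P))} with hT
  have hsT : s ∈ T := ⟨hs, hQ ▸ hsee⟩
  have hTc : IsClosed T := by
    have : IsClosed {t : ℝ | Γ.Sees P (C + t • (C - P))} :=
      (view_closed (Γ := Γ) P).preimage (f := fun t : ℝ => C + t • (C - P)) (by fun_prop)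
    exact isClosed_Ici.inter this
  obtain ⟨M, hM⟩ := Γ.compact.isBounded.exists_norm_le
  have hTb : BddAbove T := by
    refine ⟨(M + ‖C‖) / ‖C - P‖, ?_⟩
    rintro t ⟨ht, hts⟩
    have h1 := hM _ (hts (right_mem_segment ℝ _ _))
    rw [le_div_iff₀ hn]
    have h2 : ‖t • (C - P)‖ ≤ ‖C + t • (C - P)‖ + ‖C‖ := by
      have := norm_sub_le (C + t • (C - P)) C
      rwa [add_sub_cancel_left] at this
    rw [norm_smul, Real.norm_of_nonneg ht] at h2
    linarith
  have hg : IsGreatest T (sSup T) :=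
    ⟨hTc.csSup_mem ⟨s, hsT⟩ hTb, fun t ht => le_csSup hTb ht⟩
  set m := sSup T
  obtain ⟨hm0, hms⟩ := hg.1
  have hdist : ∀ t : ℝ, 0 ≤ t → dist P (C + t • (C - P)) = (1 + t) * ‖C - P‖ := by
    intro t ht
    rw [dist_comm, dist_eq_norm, show C + t • (C - P) - P = (1 + t) • (C - P) by module,
      norm_smul, Real.norm_of_nonneg (by linarith)]
  refine ⟨C + m • (C - P), ⟨m, hm0, rfl⟩, ?_, hms, ?_, ?_⟩
  · rw [Γ.closed.frontier_eq]
    refine ⟨hms (right_mem_segment ℝ _ _), fun hi => ?_⟩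
    obtain ⟨r, hr, hb⟩ := Metric.isOpen_iff.1 isOpen_interior _ hi
    obtain ⟨δ, hδ, hsm⟩ := small_ball (C + m • (C - P)) (C - P) hr
    have : m + δ / 2 ∈ T := by
      refine ⟨by linarith, ?_⟩
      rw [sees_ray (by linarith)]
      rw [sees_ray (by linarith)] at hms
      intro l h1 h2
      rcases le_or_gt l m with h | h
      · exact hms l h1 h
      · have := hb (hsm (l - m) (by rw [abs_of_pos (by linarith)]; linarith))
        have h3 := mem_of_interior this
        convert h3 using 1
        module
    have := hg.2 this
    linarith
  · rintro W' ⟨t, ht, rfl⟩ - hW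
    rw [hdist t ht, hdist m hm0]
    have : t ≤ m := hg.2 ⟨ht, hW⟩
    gcongr
  · have hsm : s ≤ m := hg.2 hsT
    rw [segment_eq_image']
    rcases eq_or_lt_of_le hm0 with h | h
    · have : s = 0 := by linarith
      exact ⟨0, ⟨le_refl _, zero_le_one⟩, by rw [hQ, this]; simp⟩
    · refine ⟨s / m, ⟨by positivity, (div_le_one h).2 hsm⟩, ?_⟩
      simp only [add_sub_cancel_left, smul_smul]
      rw [div_mul_cancel₀ _ h.ne', hQ]

theorem window_of_vertex {A : Set Pt} (hg : Γ.GP A) {P Q : Pt} {i : ℤ}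
    (hQ : Q ∈ interior Γ.carrier) (hsee : Γ.Sees P Q) (hC : Γ.vertex i ∈ segment ℝ P Q)
    (hCP : Γ.vertex i ≠ P) : ∃ w, Γ.IsWindow P w ∧ Q ∈ w := by
  have hCQ : Γ.vertex i ≠ Q := by
    intro h; exact not_interior (Γ.vertex_mem_frontier i) (h ▸ hQ)
  have hPQ := (sees_iff P Q).1 hsee
  rw [segment_eq_image'] at hC
  obtain ⟨t, ⟨ht0, ht1⟩, htC⟩ := hC
  simp only at htC
  have ht0' : 0 < t := by
    rcases eq_or_lt_of_le ht0 with h | h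
    · exfalso; apply hCP; rw [← htC, ← h]; simp
    · exact h
  have ht1' : t < 1 := by
    rcases eq_or_lt_of_le ht1 with h | h
    · exfalso; apply hCQ; rw [← htC, h]; simp
    · exact h
  have hD := hg.D i
  obtain ⟨r, hr, hloc⟩ := Γ.vertex_local hD
  have hne1 : Γ.e1 i = Γ.vertex (i - 1) - Γ.vertex i := rfl
  have hne2 : Γ.e2 i = Γ.vertex (i + 1) - Γ.vertex i := rfl
  set C := Γ.vertex i with hCdef
  set E1 := Γ.e1 i
  set E2 := Γ.e2 i
  set D := _root_.crs E1 E2 with hDd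
  have hD2 : 0 < D * D := mul_self_pos.2 hD
  set u := Q - P with hu
  have hu0 : u ≠ 0 := by
    intro h; apply hCP; rw [← htC, h]; simp
  have hCPu : C - P = t • u := by rw [← htC]; simp
  -- both sides in the polygon
  obtain ⟨δ, hδ, hsm⟩ := small_ball C u hr
  obtain ⟨ε, hε0, hεδ, hεt, hεt1⟩ : ∃ ε : ℝ, 0 < ε ∧ ε < δ ∧ ε ≤ t ∧ ε ≤ 1 - t := by
    refine ⟨min (δ / 2) (min t (1 - t)), ?_, ?_, ?_, ?_⟩
    · exact lt_min (by linarith) (lt_min ht0' (by linarith))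
    · exact (min_le_left _ _).trans_lt (by linarith)
    · exact (min_le_right _ _).trans (min_le_left _ _)
    · exact (min_le_right _ _).trans (min_le_right _ _)
  have hpl : C + ε • u ∈ Γ.carrier := by
    have := hPQ (t + ε) (by linarith) (by linarith)
    convert this using 1; rw [← htC]; module
  have hmi : C + (-ε) • u ∈ Γ.carrier := by
    have := hPQ (t - ε) (by linarith) (by linarith)
    convert this using 1; rw [← htC]; module
  have hplb := hsm ε (by rwa [abs_of_pos hε0])
  have hmib := hsm (-ε) (by rwa [abs_neg, abs_of_pos hε0])
  rcases hloc with ⟨-, hext⟩ | ⟨hext, -⟩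
  · exfalso
    have h1 := fun h => hext _ hplb h hpl
    have h2 := fun h => hext _ hmib h hmi
    simp only [add_sub_cancel_left, crs_smul_left, crs_smul_right] at h1 h2
    have h1 := not_or.1 h1
    have h2 := not_or.1 h2
    have ha : _root_.crs u E2 * D = 0 := by nlinarith
    have hb : _root_.crs E1 u * D = 0 := by nlinarith
    exact hu0 (eq_zero_of_crs hD ((mul_eq_zero.1 ha).resolve_right hD)
      ((mul_eq_zero.1 hb).resolve_right hD))
  · have h1 := fun h h' => hext _ hplb h h' hpl
    have h2 := fun h h' => hext _ hmib h h' hmi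
    simp only [add_sub_cancel_left, crs_smul_left, crs_smul_right] at h1 h2
    have hrefl : Γ.IsReflexCorner i := by
      obtain ⟨δ', hδ', hsm'⟩ := small_ball C (E1 + E2) hr
      refine ⟨δ', hδ', fun η h0 h1 => ?_⟩
      rw [← hCdef, ← hne1, ← hne2]
      refine hext _ (hsm' η (by rwa [abs_of_pos h0])) ?_ ?_
      · rw [add_sub_cancel_left, crs_smul_left, crs_add_left, crs_self, ← hDd]
        nlinarith
      · rw [add_sub_cancel_left, crs_smul_right, crs_add_right, crs_self, ← hDd]
        nlinarith
    have hsC : Γ.Sees P C := by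
      refine Set.Subset.trans ?_ hsee
      refine (convex_segment P Q).segment_subset (left_mem_segment _ _ _) ?_
      rw [segment_eq_image']; exact ⟨t, ⟨ht0, ht1⟩, htC⟩
    have hprod : 0 ≤ _root_.crs u E1 * _root_.crs u E2 := by
      by_contra! hneg
      rw [crs_swap u E1] at hneg
      have hab : 0 < (_root_.crs u E2 * D) * (_root_.crs E1 u * D) := by
        have : 0 < _root_.crs E1 u * _root_.crs u E2 := by linarith
        nlinarith
      rcases pos_and_pos_or_neg_and_neg_of_mul_pos hab with ⟨p, q⟩ | ⟨p, q⟩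
      · exact h1 (by nlinarith) (by nlinarith)
      · exact h2 (by nlinarith) (by nlinarith)
    have hfeas : Γ.IsFeasible P i := by
      refine ⟨hrefl, hCP.symm, hsC, ?_⟩
      have hv0 : _root_.crs u (C - P) = 0 := by rw [hCPu, crs_smul_right, crs_self, mul_zero]
      have hv1 : _root_.crs u (Γ.vertex (i - 1) - P) = _root_.crs u E1 := by
        rw [show Γ.vertex (i - 1) - P = E1 + (C - P) by rw [hne1]; abel, crs_add_right, hv0,
          add_zero]
      have hv2 : _root_.crs u (Γ.vertex (i + 1) - P) = _root_.crs u E2 := by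
        rw [show Γ.vertex (i + 1) - P = E2 + (C - P) by rw [hne2]; abel, crs_add_right, hv0,
          add_zero]
      obtain ⟨v, hv⟩ := exists_crs_ne hu0
      have hf0 : crsL u ≠ 0 := by
        intro h; apply hv; rw [← crsL_apply, h]; rfl
      by_cases hs : 0 ≤ _root_.crs u E1 ∧ 0 ≤ _root_.crs u E2
      · exact ⟨crsL u, hf0, hv0, hs.1.trans_eq hv1.symm, hs.2.trans_eq hv2.symm⟩
      · have hs' : _root_.crs u E1 ≤ 0 ∧ _root_.crs u E2 ≤ 0 := by
          rcases mul_nonneg_iff.1 hprod with h | h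
          · exact absurd h hs
          · exact h
        refine ⟨-crsL u, neg_ne_zero.2 hf0, ?_, ?_, ?_⟩
        · rw [LinearMap.neg_apply, crsL_apply, ← hCdef, hv0, neg_zero]
        · rw [LinearMap.neg_apply, crsL_apply, hv1]; linarith
        · rw [LinearMap.neg_apply, crsL_apply, hv2]; linarith
    have hQC : Q = C + ((1 - t) / t) • (C - P) := by
      rw [hCPu, smul_smul, div_mul_cancel₀ _ ht0'.ne', ← htC, hu]; module
    obtain ⟨W, hW1, hW2, hW3, hW4, hW5⟩ := exists_far (Γ := Γ) hCP.symm
      (div_nonneg (by linarith) ht0) hQC hsee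
    exact ⟨segment ℝ C W, ⟨i, W, hfeas, hW1, hW2, hW3, hW4, rfl⟩, hW5⟩

theorem not_along {P Q v : Pt} (hseg : segment ℝ P v ⊆ frontier Γ.carrier)
    (hv : v ∉ segment ℝ P Q) (hQ : Q ∈ interior Γ.carrier) {s : ℝ} (h : Q - P = s • (v - P)) :
    s < 0 := by
  by_contra! hs
  rcases le_or_gt s 1 with h1 | h1
  · refine not_interior (hseg ?_) hQ
    rw [segment_eq_image']
    exact ⟨s, ⟨hs, h1⟩, by simp only [← h]; abel⟩
  · apply hv
    rw [segment_eq_image']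
    refine ⟨s⁻¹, ⟨by positivity, inv_le_one_of_one_le₀ h1.le⟩, ?_⟩
    simp only [h, smul_smul]
    rw [inv_mul_cancel₀ (by linarith)]; module

theorem edge_subset_frontier (i : ℤ) : Γ.edge i ⊆ frontier Γ.carrier :=
  fun _ hx => (Γ.mem_frontier_iff _).2 ⟨i, hx⟩

theorem seg_succ (i : ℤ) :
    segment ℝ (Γ.vertex i) (Γ.vertex (i + 1)) ⊆ frontier Γ.carrier := edge_subset_frontier i

theorem seg_pred (i : ℤ) :
    segment ℝ (Γ.vertex i) (Γ.vertex (i - 1)) ⊆ frontier Γ.carrier := by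
  have := edge_subset_frontier (Γ := Γ) (i - 1)
  rw [edge, sub_add_cancel, segment_symm] at this
  exact this

theorem segment_interior {A : Set Pt} (hg : Γ.GP A) {P Q : Pt} (hP : P ∈ A)
    (hQ : Q ∈ interior Γ.carrier) (hsee : Γ.Sees P Q)
    (hnv : ∀ i, Γ.vertex i ∈ segment ℝ P Q → Γ.vertex i = P) {t : ℝ} (h0 : 0 < t) (h1 : t ≤ 1) :
    P + t • (Q - P) ∈ interior Γ.carrier := by
  by_cases hPQ : P = Q
  · subst hPQ; simpa using hQ
  have hsee' := (sees_iff P Q).1 hsee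
  by_contra hni
  set X := P + t • (Q - P) with hX
  have hXseg : X ∈ segment ℝ P Q := by
    rw [segment_eq_image']; exact ⟨t, ⟨h0.le, h1⟩, rfl⟩
  have hXf : X ∈ frontier Γ.carrier := by
    rw [Γ.closed.frontier_eq]; exact ⟨hsee' t h0.le h1, hni⟩
  have hu0 : Q - P ≠ 0 := sub_ne_zero.2 (Ne.symm hPQ)
  have hXP : X ≠ P := by
    intro h
    rw [hX, add_eq_left, smul_eq_zero] at h
    rcases h with h | h
    · linarith
    · exact hu0 h
  have hXv : ∀ k, X ≠ Γ.vertex k := by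
    intro k hk
    exact hXP (hk.trans (hnv k (hk ▸ hXseg)))
  have h1' : t < 1 := by
    rcases eq_or_lt_of_le h1 with h | h
    · exfalso; apply hni; rw [hX, h]; simpa using hQ
    · exact h
  obtain ⟨i, hi⟩ := (Γ.mem_frontier_iff X).1 hXf
  have hd : Γ.vertex (i + 1) - Γ.vertex i ≠ 0 := sub_ne_zero.2 (vertex_ne_succ i).symm
  have hia : ∃ a : ℝ, 0 ≤ a ∧ a ≤ 1 ∧
      X = Γ.vertex i + a • (Γ.vertex (i + 1) - Γ.vertex i) := by
    rw [edge, segment_eq_image'] at hi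
    obtain ⟨a, ha, h⟩ := hi
    exact ⟨a, ha.1, ha.2, h.symm⟩
  obtain ⟨a, ha0, ha1, haX⟩ := hia
  set d := Γ.vertex (i + 1) - Γ.vertex i with hdd
  by_cases hc : crs d (Q - P) = 0
  · -- along the edge
    have hline : crs d (P - Γ.vertex i) = 0 := by
      have : P - Γ.vertex i = a • d - t • (Q - P) := by
        have e : P - Γ.vertex i = (X - Γ.vertex i) - t • (Q - P) := by rw [hX]; abel
        rw [e, haX, add_sub_cancel_left]
      rw [this, crs_sub_right, crs_smul_right, crs_smul_right, crs_self, hc]; ring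
    by_cases hPi : P = Γ.vertex i
    · have hv : Γ.vertex (i + 1) ∉ segment ℝ P Q := fun h =>
        (vertex_ne_succ i) ((hnv _ h).trans hPi).symm
      have hs := not_along (Γ := Γ) (P := P) (Q := Q) (v := Γ.vertex (i + 1)) (s := a / t)
        (by rw [hPi]; exact seg_succ i) hv hQ (by
          have : t • (Q - P) = a • (Γ.vertex (i + 1) - P) := by
            have e : t • (Q - P) = X - P := by rw [hX]; abel
            rw [e, haX, hdd, hPi]; abel
          rw [div_eq_inv_mul, ← smul_smul, ← this, smul_smul, inv_mul_cancel₀ h0.ne', one_smul])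
      have : 0 ≤ a / t := by positivity
      linarith
    by_cases hPi' : P = Γ.vertex (i + 1)
    · have hv : Γ.vertex i ∉ segment ℝ P Q := fun h =>
        (vertex_ne_succ i) ((hnv _ h).trans hPi')
      have hs := not_along (Γ := Γ) (P := P) (Q := Q) (v := Γ.vertex i) (s := (1 - a) / t)
        (by rw [hPi', segment_symm]; exact seg_succ i) hv hQ (by
          have : t • (Q - P) = (1 - a) • (Γ.vertex i - P) := by
            have e : t • (Q - P) = X - P := by rw [hX]; abel
            rw [e, haX, hdd, hPi']; module
          rw [div_eq_inv_mul, ← smul_smul, ← this, smul_smul, inv_mul_cancel₀ h0.ne', one_smul])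
      have : 0 ≤ (1 - a) / t := div_nonneg (by linarith) h0.le
      linarith
    exact hg.crs (vmem A i) (vmem A (i + 1)) (Or.inr hP) (vertex_ne_succ i) (Ne.symm hPi)
      (Ne.symm hPi') hline
  · obtain ⟨r, hr, s, hs, -, hext⟩ := Γ.edge_local hi hXv hd
      (by rw [haX, show Γ.vertex i - (Γ.vertex i + a • d) = (-a) • d by module, crs_smul_right,
            crs_self, mul_zero])
      (by rw [haX, show Γ.vertex (i + 1) - (Γ.vertex i + a • d) = (1 - a) • d by
            rw [hdd]; module, crs_smul_right, crs_self, mul_zero])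
    obtain ⟨δ, hδ, hsm⟩ := small_ball X (Q - P) hr
    obtain ⟨ε, hε0, hεδ, hεt, hεt1⟩ : ∃ ε : ℝ, 0 < ε ∧ ε < δ ∧ ε ≤ t ∧ ε ≤ 1 - t := by
      refine ⟨min (δ / 2) (min t (1 - t)), ?_, ?_, ?_, ?_⟩
      · exact lt_min (by linarith) (lt_min h0 (by linarith))
      · exact (min_le_left _ _).trans_lt (by linarith)
      · exact (min_le_right _ _).trans (min_le_left _ _)
      · exact (min_le_right _ _).trans (min_le_right _ _)
    have hpl : X + ε • (Q - P) ∈ Γ.carrier := by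
      have := hsee' (t + ε) (by linarith) (by linarith)
      convert this using 1; rw [hX]; module
    have hmi : X + (-ε) • (Q - P) ∈ Γ.carrier := by
      have := hsee' (t - ε) (by linarith) (by linarith)
      convert this using 1; rw [hX]; module
    have hplb := hsm ε (by rwa [abs_of_pos hε0])
    have hmib := hsm (-ε) (by rwa [abs_neg, abs_of_pos hε0])
    have k1 := fun h => hext _ hplb h hpl
    have k2 := fun h => hext _ hmib h hmi
    simp only [add_sub_cancel_left, crs_smul_right] at k1 k2
    have hne : s * (ε * crs d (Q - P)) ≠ 0 := mul_ne_zero hs (mul_ne_zero hε0.ne' hc)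
    rcases lt_or_gt_of_ne hne with h | h
    · exact k1 h
    · exact k2 (by linarith)

theorem locally_seen {A : Set Pt} (hg : Γ.GP A) {P Q : Pt} (hP : P ∈ A)
    (hQ : Q ∈ interior Γ.carrier) (hsee : Γ.Sees P Q) (hw : ∀ w, Γ.IsWindow P w → Q ∉ w) :
    ∀ᶠ x in nhds Q, Γ.Sees P x := by
  have hnv : ∀ i, Γ.vertex i ∈ segment ℝ P Q → Γ.vertex i = P := by
    intro i hi
    by_contra hne
    obtain ⟨w, hw1, hw2⟩ := window_of_vertex hg hQ hsee hi hne
    exact hw w hw1 hw2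
  have hint : ∀ t : ℝ, 0 < t → t ≤ 1 → P + t • (Q - P) ∈ interior Γ.carrier :=
    fun t h0 h1 => segment_interior hg hP hQ hsee hnv h0 h1
  have hPc : P ∈ Γ.carrier := hsee (left_mem_segment ℝ _ _)
  have hcont : Continuous (fun z : Pt × ℝ => P + z.2 • (z.1 - P)) := by fun_prop
  have hmain : ∀ t ∈ Set.Icc (0 : ℝ) 1, ∀ᶠ z : Pt × ℝ in nhds (Q, t),
      (0 ≤ z.2 → P + z.2 • (z.1 - P) ∈ Γ.carrier) := by
    intro t ht
    by_cases hin : P + t • (Q - P) ∈ interior Γ.carrier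
    · have := hcont.continuousAt.eventually_mem (x := (Q, t)) (isOpen_interior.mem_nhds hin)
      filter_upwards [this] with z hz _
      exact mem_of_interior hz
    · have ht0 : t = 0 := by
        by_contra hne
        exact hin (hint t (lt_of_le_of_ne ht.1 (Ne.symm hne)) ht.2)
      subst ht0
      simp only [zero_smul, add_zero] at hin
      have hPf : P ∈ frontier Γ.carrier := by
        rw [Γ.closed.frontier_eq]; exact ⟨hPc, hin⟩
      obtain ⟨i, hPi⟩ : ∃ i, P = Γ.vertex i := by
        by_contra! hne
        obtain ⟨i, hi⟩ := (Γ.mem_frontier_iff P).1 hPf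
        refine hg.crs (vmem A i) (vmem A (i + 1)) (Or.inr hP) (vertex_ne_succ i)
          (hne i).symm (hne (i + 1)).symm ?_
        exact segment_subset_line _ _ (by simp [crs]) (crs_self _) hi
      have hPQ : Q ≠ P := by
        rintro rfl; exact hin hQ
      have hv1 : Γ.vertex (i - 1) ∉ segment ℝ P Q := fun h =>
        (vertex_ne_pred i) ((hnv _ h).trans hPi).symm
      have hv2 : Γ.vertex (i + 1) ∉ segment ℝ P Q := fun h =>
        (vertex_ne_succ i) ((hnv _ h).trans hPi).symm
      have hD := hg.D i
      have na1 : ∀ s : ℝ, Q - P = s • Γ.e1 i → s < 0 := fun s hs =>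
        not_along (by rw [hPi]; exact seg_pred i) hv1 hQ (by rw [hs, hPi]; rfl)
      have na2 : ∀ s : ℝ, Q - P = s • Γ.e2 i → s < 0 := fun s hs =>
        not_along (by rw [hPi]; exact seg_succ i) hv2 hQ (by rw [hs, hPi]; rfl)
      obtain ⟨r, hr, hloc⟩ := Γ.vertex_local hD
      rw [← hPi] at hloc
      set E1 := Γ.e1 i
      set E2 := Γ.e2 i
      set D := crs E1 E2 with hDd
      have hD2 : 0 < D * D := mul_self_pos.2 hD
      have hE1' : E1 ≠ 0 := by intro h; apply hD; rw [hDd, h]; simp [crs]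
      have hE2' : E2 ≠ 0 := by intro h; apply hD; rw [hDd, h]; simp [crs]
      have hna : ¬ (crs (Q - P) E2 * D = 0 ∧ 0 ≤ crs E1 (Q - P) * D) := by
        rintro ⟨h1, h2⟩
        have h1 := (mul_eq_zero.1 h1).resolve_right hD
        rw [crs_swap, neg_eq_zero] at h1
        obtain ⟨s, hs⟩ := par hE2' h1
        have := na2 s hs
        rw [hs, crs_smul_right, ← hDd] at h2
        nlinarith
      have hnb : ¬ (crs E1 (Q - P) * D = 0 ∧ 0 ≤ crs (Q - P) E2 * D) := by
        rintro ⟨h1, h2⟩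
        have h1 := (mul_eq_zero.1 h1).resolve_right hD
        obtain ⟨s, hs⟩ := par hE1' h1
        have := na1 s hs
        rw [hs, crs_smul_left, ← hDd] at h2
        nlinarith
      have hballev : ∀ᶠ z : Pt × ℝ in nhds (Q, (0 : ℝ)), P + z.2 • (z.1 - P) ∈ Metric.ball P r := by
        have := hcont.continuousAt.eventually_mem (x := (Q, (0 : ℝ)))
          (Metric.isOpen_ball.mem_nhds (show P + (0 : ℝ) • (Q - P) ∈ Metric.ball P r by
            simpa using hr))
        exact this
      have ca : Continuous (fun z : Pt × ℝ => crs (z.1 - P) E2 * D) :=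
        (Continuous.crs' (by fun_prop) continuous_const).mul continuous_const
      have cb : Continuous (fun z : Pt × ℝ => crs E1 (z.1 - P) * D) :=
        (Continuous.crs' continuous_const (by fun_prop)).mul continuous_const
      -- a test point near P
      obtain ⟨δ, hδ, hsm⟩ := small_ball P (Q - P) hr
      obtain ⟨ε, hε0, hεδ, hε1⟩ : ∃ ε : ℝ, 0 < ε ∧ ε < δ ∧ ε ≤ 1 :=
        ⟨min (δ / 2) 1, lt_min (by linarith) one_pos,
          (min_le_left _ _).trans_lt (by linarith), min_le_right _ _⟩
      have htest := (sees_iff P Q).1 hsee ε hε0.le hε1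
      have htb := hsm ε (by rwa [abs_of_pos hε0])
      rcases hloc with ⟨hi, he⟩ | ⟨he, hi⟩
      · have hh := fun h => he _ htb h htest
        simp only [add_sub_cancel_left, crs_smul_left, crs_smul_right] at hh
        have hh := not_or.1 hh
        have a0 : 0 ≤ crs (Q - P) E2 * D := by
          by_contra! h; apply hh.1; nlinarith
        have b0 : 0 ≤ crs E1 (Q - P) * D := by
          by_contra! h; apply hh.2; nlinarith
        have a1 : 0 < crs (Q - P) E2 * D := lt_of_le_of_ne a0 fun h => hna ⟨h.symm, b0⟩
        have b1 : 0 < crs E1 (Q - P) * D := lt_of_le_of_ne b0 fun h => hnb ⟨h.symm, a0⟩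
        filter_upwards [hballev, ca.continuousAt.eventually_mem (x := (Q, (0 : ℝ)))
            (isOpen_Ioi.mem_nhds a1),
          cb.continuousAt.eventually_mem (x := (Q, (0 : ℝ))) (isOpen_Ioi.mem_nhds b1)]
          with z hz hza hzb hz0
        rcases eq_or_lt_of_le hz0 with h | h
        · rw [← h]; simpa using hPc
        · refine mem_of_interior (hi _ hz ?_ ?_)
          · rw [add_sub_cancel_left, crs_smul_left, mul_assoc]; exact mul_pos h hza
          · rw [add_sub_cancel_left, crs_smul_right, mul_assoc]; exact mul_pos h hzb
      · have hh := fun h h' => he _ htb h h' htest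
        simp only [add_sub_cancel_left, crs_smul_left, crs_smul_right] at hh
        have hor : crs (Q - P) E2 * D < 0 ∨ crs E1 (Q - P) * D < 0 := by
          by_contra! hcon
          obtain ⟨a0, b0⟩ := hcon
          have a1 : 0 < crs (Q - P) E2 * D := lt_of_le_of_ne a0 fun h => hna ⟨h.symm, b0⟩
          have b1 : 0 < crs E1 (Q - P) * D := lt_of_le_of_ne b0 fun h => hnb ⟨h.symm, a0⟩
          exact hh (by rw [mul_assoc]; positivity) (by rw [mul_assoc]; positivity)
        have hor' : ∀ᶠ z : Pt × ℝ in nhds (Q, (0 : ℝ)),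
            crs (z.1 - P) E2 * D < 0 ∨ crs E1 (z.1 - P) * D < 0 := by
          rcases hor with h | h
          · filter_upwards [ca.continuousAt.eventually_mem (x := (Q, (0 : ℝ)))
              (isOpen_Iio.mem_nhds h)] with z hz
            exact Or.inl hz
          · filter_upwards [cb.continuousAt.eventually_mem (x := (Q, (0 : ℝ)))
              (isOpen_Iio.mem_nhds h)] with z hz
            exact Or.inr hz
        filter_upwards [hballev, hor'] with z hz hzo hz0
        rcases eq_or_lt_of_le hz0 with h | h
        · rw [← h]; simpa using hPc
        · refine mem_of_interior (hi _ hz ?_)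
          rw [add_sub_cancel_left, crs_smul_left, crs_smul_right, mul_assoc, mul_assoc]
          rcases hzo with h' | h'
          · exact Or.inl (mul_neg_of_pos_of_neg h h')
          · exact Or.inr (mul_neg_of_pos_of_neg h h')
  have := isCompact_Icc.eventually_forall_of_forall_eventually
    (P := fun (x : Pt) (t : ℝ) => 0 ≤ t → P + t • (x - P) ∈ Γ.carrier) hmain
  filter_upwards [this] with x hx
  rw [sees_iff]
  intro t h0 h1
  exact hx t ⟨h0, h1⟩ h0

theorem locally_const {A : Set Pt} (hg : Γ.GP A) {P Q : Pt} (hP : P ∈ A)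
    (hQ : Q ∈ interior Γ.carrier) (hw : ∀ w, Γ.IsWindow P w → Q ∉ w) :
    (∀ᶠ x in nhds Q, Γ.Sees P x) ∨ (∀ᶠ x in nhds Q, ¬ Γ.Sees P x) := by
  by_cases h : Γ.Sees P Q
  · exact Or.inl (locally_seen hg hP hQ h hw)
  · right
    exact (view_closed (Γ := Γ) P).isOpen_compl.mem_nhds h

theorem window_seg {P : Pt} {w : Set Pt} (h : Γ.IsWindow P w) :
    ∃ a b, w = segment ℝ a b := by
  obtain ⟨i, W, -, -, -, -, -, hw⟩ := h
  exact ⟨_, _, hw⟩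

theorem windows_finite {A : Set Pt} (hA : A.Finite) :
    {w : Set Pt | ∃ P ∈ A, Γ.IsWindow P w}.Finite := by
  classical
  have hsub : {w : Set Pt | ∃ P ∈ A, Γ.IsWindow P w} ⊆
      ⋃ P ∈ A, ⋃ c ∈ Set.range Γ.vertex, {w : Set Pt | P ≠ c ∧ ∃ W : Pt,
        (∃ t : ℝ, 0 ≤ t ∧ W = c + t • (c - P)) ∧ W ∈ frontier Γ.carrier ∧ Γ.Sees P W ∧
        (∀ W' : Pt, (∃ t : ℝ, 0 ≤ t ∧ W' = c + t • (c - P)) →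
          W' ∈ frontier Γ.carrier → Γ.Sees P W' → dist P W' ≤ dist P W) ∧
        w = segment ℝ c W} := by
    rintro w ⟨P, hP, i, W, hf, h⟩
    simp only [mem_iUnion]
    exact ⟨P, hP, Γ.vertex i, ⟨i, rfl⟩, hf.2.1, W, h⟩
  refine Set.Finite.subset ?_ hsub
  refine hA.biUnion fun P _ => Γ.vertices_finite.biUnion fun c _ => ?_
  apply Set.Subsingleton.finite
  rintro w ⟨hne, W, ⟨t, ht, rfl⟩, hf, hs, hmax, rfl⟩ w' ⟨-, W', ⟨t', ht', rfl⟩, hf', hs', hmax', rfl⟩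
  have hn : 0 < ‖c - P‖ := norm_pos_iff.2 (sub_ne_zero.2 hne.symm)
  have hdist : ∀ t : ℝ, 0 ≤ t → dist P (c + t • (c - P)) = (1 + t) * ‖c - P‖ := by
    intro t ht
    rw [dist_comm, dist_eq_norm, show c + t • (c - P) - P = (1 + t) • (c - P) by module,
      norm_smul, Real.norm_of_nonneg (by linarith)]
  have h1 := hmax _ ⟨t', ht', rfl⟩ hf' hs'
  have h2 := hmax' _ ⟨t, ht, rfl⟩ hf hs
  rw [hdist t ht, hdist t' ht'] at h1 h2
  have h3 := le_of_mul_le_mul_right h1 hn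
  have h4 := le_of_mul_le_mul_right h2 hn
  have : t = t' := by linarith
  rw [this]

theorem windows_closed {A : Set Pt} (hA : A.Finite) : IsClosed (Γ.windows A) := by
  unfold windows
  rw [sUnion_eq_biUnion]
  refine (windows_finite hA).isClosed_biUnion ?_
  rintro w ⟨P, -, h⟩
  obtain ⟨a, b, rfl⟩ := window_seg h
  exact segment_closed a b

theorem finite_dense {F : Set (Set Pt)} (hF : F.Finite) (h : ∀ s ∈ F, ∃ a b, s = segment ℝ a b) :
    Dense (⋃₀ F)ᶜ := by
  induction F, hF using Set.Finite.induction_on with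
  | empty => simp
  | @insert s F hs hF ih =>
    rw [sUnion_insert, compl_union]
    obtain ⟨a, b, rfl⟩ := h s (mem_insert _ _)
    exact (segment_compl_dense a b).inter_of_isOpen_left
      (ih fun s hs => h s (mem_insert_of_mem _ hs)) (segment_closed a b).isOpen_compl

theorem windows_dense {A : Set Pt} (hA : A.Finite) : Dense (Γ.windows A)ᶜ := by
  refine finite_dense (windows_finite hA) ?_
  rintro w ⟨P, -, h⟩
  exact window_seg h

theorem regionspace_open {A : Set Pt} (hA : A.Finite) :
    IsOpen (interior Γ.carrier \ Γ.windows A) :=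
  isOpen_interior.sdiff (windows_closed hA)

theorem region_open {A R : Set Pt} (hA : A.Finite) (hR : R ∈ Γ.regionInteriors A) : IsOpen R := by
  obtain ⟨x, hx, rfl⟩ := hR
  exact (regionspace_open hA).connectedComponentIn

theorem region_sub {A R : Set Pt} (hR : R ∈ Γ.regionInteriors A) :
    R ⊆ interior Γ.carrier \ Γ.windows A := by
  obtain ⟨x, hx, rfl⟩ := hR
  exact connectedComponentIn_subset _ _

theorem region_eq {A R : Set Pt} (hR : R ∈ Γ.regionInteriors A) {y : Pt} (hy : y ∈ R) :
    R = connectedComponentIn (interior Γ.carrier \ Γ.windows A) y := by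
  obtain ⟨x, hx, rfl⟩ := hR
  exact connectedComponentIn_eq hy

theorem region_preconn {A R : Set Pt} (hR : R ∈ Γ.regionInteriors A) : IsPreconnected R := by
  obtain ⟨x, hx, rfl⟩ := hR
  exact isPreconnected_connectedComponentIn

theorem region_nonempty {A R : Set Pt} (hR : R ∈ Γ.regionInteriors A) : R.Nonempty := by
  obtain ⟨x, hx, rfl⟩ := hR
  exact ⟨x, mem_connectedComponentIn hx⟩

theorem region_absorb {A R S : Set Pt} (hR : R ∈ Γ.regionInteriors A) (hS : IsPreconnected S)
    (hsub : S ⊆ interior Γ.carrier \ Γ.windows A) {y : Pt} (hy : y ∈ R) (hyS : y ∈ S) :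
    S ⊆ R := by
  rw [region_eq hR hy]
  exact hS.subset_connectedComponentIn hyS hsub

/-- constancy of visibility in a region -/
theorem region_const {A R : Set Pt} (hg : Γ.GP A) (hR : R ∈ Γ.regionInteriors A) {P x : Pt}
    (hP : P ∈ A) (hx : x ∈ R) (hs : Γ.Sees P x) : Γ.SeesAll P R := by
  have hsub : R ⊆ interior {Q | Γ.Sees P Q} ∪ {Q | Γ.Sees P Q}ᶜ := by
    intro y hy
    by_cases h : Γ.Sees P y
    · left
      have hy' := region_sub hR hy
      refine mem_interior_iff_mem_nhds.2 (locally_seen hg hP hy'.1 h ?_)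
      intro w hw hyw
      exact hy'.2 ⟨w, ⟨P, hP, hw⟩, hyw⟩
    · right; exact h
  have := (region_preconn hR).subset_left_of_subset_union isOpen_interior
    (view_closed (Γ := Γ) P).isOpen_compl (disjoint_compl_right.mono_left interior_subset) hsub
    ⟨x, hx, ((hsub hx).resolve_right fun h => h hs)⟩
  intro y hy
  exact interior_subset (this hy)

theorem region_transfer {A R R' : Set Pt} (hg : Γ.GP A)
    (hR : R ∈ Γ.regionInteriors A) (hR' : R' ∈ Γ.regionInteriors A) {P Q : Pt} (hP : P ∈ A)
    (hQ : Q ∈ interior Γ.carrier) (hw : ∀ w, Γ.IsWindow P w → Q ∉ w)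
    (h : Q ∈ closure R) (h' : Q ∈ closure R') (hs : Γ.SeesAll P R) : Γ.SeesAll P R' := by
  have hf := mem_closure_iff_frequently.1 h
  have hf' := mem_closure_iff_frequently.1 h'
  rcases locally_const hg hP hQ hw with hl | hl
  · obtain ⟨y, hy, hys⟩ := (hf'.and_eventually hl).exists
    exact region_const hg hR' hP hy hys
  · obtain ⟨y, hy, hys⟩ := (hf.and_eventually hl).exists
    exact absurd (hs y hy) hys

theorem line_transfer {C d p q z : Pt} (hd : d ≠ 0) (hpq : p ≠ q) (hp : crs d (p - C) = 0)
    (hq : crs d (q - C) = 0) (hz : crs (q - p) (z - p) = 0) : crs d (z - C) = 0 := by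
  have h1 : crs d (q - p) = 0 := by
    rw [show q - p = (q - C) - (p - C) by abel, crs_sub_right, hp, hq, sub_zero]
  obtain ⟨r, hr⟩ := par hd h1
  have hr0 : r ≠ 0 := by
    rintro rfl; rw [zero_smul] at hr; exact hpq (sub_eq_zero.1 hr).symm
  rw [hr, crs_smul_left] at hz
  have hz := (mul_eq_zero.1 hz).resolve_left hr0
  rw [show z - C = (z - p) + (p - C) by abel, crs_add_right, hz, hp, add_zero]

/-- windows are on the line through the guard and the corner -/
theorem window_line {P : Pt} {w : Set Pt} (h : Γ.IsWindow P w) :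
    ∃ i, P ≠ Γ.vertex i ∧ ∀ y ∈ w, ∃ t : ℝ, 0 ≤ t ∧ y = Γ.vertex i + t • (Γ.vertex i - P) := by
  obtain ⟨i, W, hf, ⟨t, ht, rfl⟩, -, -, -, rfl⟩ := h
  refine ⟨i, hf.2.1, fun y hy => ?_⟩
  rw [segment_eq_image'] at hy
  obtain ⟨s, hs, rfl⟩ := hy
  refine ⟨s * t, mul_nonneg hs.1 ht, ?_⟩
  simp only [add_sub_cancel_left, smul_smul]

theorem window_line' {P : Pt} {w : Set Pt} {C d p q : Pt} {i : ℤ} (hd : d ≠ 0)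
    (hray : ∀ y ∈ w, ∃ t : ℝ, 0 ≤ t ∧ y = Γ.vertex i + t • (Γ.vertex i - P))
    (hp : p ∈ w) (hq : q ∈ w) (hpq : p ≠ q) (hpC : crs d (p - C) = 0) (hqC : crs d (q - C) = 0) :
    crs d (P - C) = 0 ∧ crs d (Γ.vertex i - C) = 0 ∧ ∀ y ∈ w, crs d (y - C) = 0 := by
  have hall : ∀ z : Pt, (∃ t : ℝ, z = Γ.vertex i + t • (Γ.vertex i - P)) →
      crs d (z - C) = 0 := by
    rintro z ⟨t, rfl⟩
    obtain ⟨a, -, ha⟩ := hray p hp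
    obtain ⟨b, -, hb⟩ := hray q hq
    refine line_transfer hd hpq hpC hqC ?_
    rw [show q - p = (b - a) • (Γ.vertex i - P) by rw [ha, hb]; module,
      show Γ.vertex i + t • (Γ.vertex i - P) - p = (t - a) • (Γ.vertex i - P) by rw [ha]; module,
      crs_smul_left, crs_smul_right, crs_self]
    ring
  refine ⟨hall P ⟨-1, by module⟩, hall _ ⟨0, by module⟩, fun y hy => ?_⟩
  obtain ⟨t, -, ht⟩ := hray y hy
  exact hall y ⟨t, ht⟩

theorem window_unique {A : Set Pt} (hg : Γ.GP A) {C d Q : Pt} (hd : d ≠ 0) {P P' : Pt}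
    (hP : P ∈ A) (hP' : P' ∈ A) {w w' : Set Pt} (hw : Γ.IsWindow P w) (hw' : Γ.IsWindow P' w')
    (hQ : Q ∈ w) (hQ' : Q ∈ w')
    (hl : ∃ p ∈ w, ∃ q ∈ w, p ≠ q ∧ crs d (p - C) = 0 ∧ crs d (q - C) = 0)
    (hl' : ∃ p ∈ w', ∃ q ∈ w', p ≠ q ∧ crs d (p - C) = 0 ∧ crs d (q - C) = 0) : P = P' := by
  by_contra hne
  obtain ⟨i, hPi, hi⟩ := window_line hw
  obtain ⟨j, hPj, hj⟩ := window_line hw'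
  obtain ⟨p, hp, q, hq, hpq, h1, h2⟩ := hl
  obtain ⟨p', hp', q', hq', hpq', h1', h2'⟩ := hl'
  obtain ⟨a1, a2, -⟩ := window_line' hd hi hp hq hpq h1 h2
  obtain ⟨b1, b2, -⟩ := window_line' hd hj hp' hq' hpq' h1' h2'
  have key : ∀ x y z : Pt, crs d (x - C) = 0 → crs d (y - C) = 0 → crs d (z - C) = 0 →
      crs (y - x) (z - x) = 0 := by
    intro x y z hx hy hz
    obtain ⟨r, hr⟩ := par hd (show crs d (y - x) = 0 by
      rw [show y - x = (y - C) - (x - C) by abel, crs_sub_right, hx, hy, sub_zero])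
    rw [hr, crs_smul_left, show z - x = (z - C) - (x - C) by abel, crs_sub_right, hx, hz]
    ring
  have e1 : P' = Γ.vertex i := by
    by_contra hn
    exact hg.crs (Or.inr hP) (Or.inr hP') (vmem A i) hne hPi hn (key _ _ _ a1 b1 a2)
  have e2 : P = Γ.vertex j := by
    by_contra hn
    exact hg.crs (Or.inr hP) (Or.inr hP') (vmem A j) hne hn hPj (key _ _ _ a1 b1 b2)
  obtain ⟨t, ht, h⟩ := hi Q hQ
  obtain ⟨s, hs, h'⟩ := hj Q hQ'
  rw [← e1] at h
  rw [← e2] at h'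
  have : (1 + t + s) • (P' - P) = 0 := by
    have e : (P' + t • (P' - P)) - (P + s • (P - P')) = 0 := by rw [← h, ← h', sub_self]
    rw [← e]; module
  rcases smul_eq_zero.1 this with h | h
  · linarith
  · exact hne (sub_eq_zero.1 h).symm

theorem adjacent_comparable {A R R' : Set Pt} (hg : Γ.GP A) (hA : A.Finite)
    (hR : R ∈ Γ.regionInteriors A) (hR' : R' ∈ Γ.regionInteriors A)
    (hadj : AdjacentRegions R R') :
    Γ.Vset A R ⊆ Γ.Vset A R' ∨ Γ.Vset A R' ⊆ Γ.Vset A R := by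
  obtain ⟨hne, C, D, hCD, hseg⟩ := hadj
  have hd : D - C ≠ 0 := sub_ne_zero.2 hCD.symm
  have hdisj : ∀ y, y ∈ R → y ∈ R' → False := by
    intro y hy hy'
    exact hne ((region_eq hR hy).trans (region_eq hR' hy').symm)
  have hline : ∀ y ∈ segment ℝ C D, crs (D - C) (y - C) = 0 := fun y hy =>
    segment_subset_line C D (by simp [crs]) (crs_self _) hy
  -- the finite family of segments
  set F : Set (Set Pt) := Set.range Γ.edge ∪ {w : Set Pt | ∃ P ∈ A, Γ.IsWindow P w} with hF
  have hFfin : F.Finite := Γ.edges_finite.union (windows_finite hA)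
  have hbad : (Set.range Γ.vertex ∪
      ⋃ s ∈ {s ∈ F | (s ∩ segment ℝ C D).Subsingleton}, s ∩ segment ℝ C D).Finite := by
    refine Γ.vertices_finite.union ?_
    refine (hFfin.subset (sep_subset _ _)).biUnion ?_
    intro s hs
    exact hs.2.finite
  have hinf : (segment ℝ C D).Infinite := by
    rw [segment_eq_image']
    refine (Set.Icc_infinite zero_lt_one).image ?_
    intro s _ t _ hst
    simp only [add_right_inj] at hst
    exact smul_left_injective ℝ hd hst
  obtain ⟨Q, hQ, hQbad⟩ := (hinf.sdiff hbad).nonempty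
  have hQv : ∀ k, Q ≠ Γ.vertex k := fun k hk => hQbad (Or.inl ⟨k, hk.symm⟩)
  have hQF : ∀ s ∈ F, Q ∈ s → ∃ p ∈ s, ∃ q ∈ s, p ≠ q ∧ crs (D - C) (p - C) = 0 ∧
      crs (D - C) (q - C) = 0 := by
    intro s hs hQs
    have : ¬ (s ∩ segment ℝ C D).Subsingleton := by
      intro hsub
      apply hQbad
      right
      simp only [mem_iUnion]
      exact ⟨s, ⟨hs, hsub⟩, hQs, hQ⟩
    rw [Set.not_subsingleton_iff] at this
    obtain ⟨p, hp, q, hq, hpq⟩ := this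
    exact ⟨p, hp.1, q, hq.1, hpq, hline p hp.2, hline q hq.2⟩
  have hQR := (hseg hQ).1
  have hQR' := (hseg hQ).2
  have hQC := hline Q hQ
  have hCQ : ∀ y, crs (D - C) (y - C) = crs (D - C) (y - Q) := by
    intro y
    rw [show y - C = (y - Q) + (Q - C) by abel, crs_add_right, hQC, add_zero]
  have hQcar : Q ∈ Γ.carrier := by
    refine closure_minimal ?_ Γ.closed hQR
    exact (region_sub hR).trans (sdiff_subset.trans interior_subset)
  by_cases hQi : Q ∈ interior Γ.carrier
  · by_cases hex : ∃ P ∈ A, ∃ w, Γ.IsWindow P w ∧ Q ∈ w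
    · obtain ⟨P, hP, w, hw, hQw⟩ := hex
      have hother : ∀ P' ∈ A, P' ≠ P → ∀ w', Γ.IsWindow P' w' → Q ∉ w' := by
        intro P' hP' hne w' hw' hQw'
        exact hne (window_unique hg hd hP' hP hw' hw hQw' hQw
          (hQF w' (Or.inr ⟨P', hP', hw'⟩) hQw') (hQF w (Or.inr ⟨P, hP, hw⟩) hQw))
      by_cases hPR : P ∈ Γ.Vset A R
      · right
        rintro P' ⟨hP', hs⟩
        by_cases h : P' = P
        · rw [h]; exact hPR
        · exact ⟨hP', region_transfer hg hR' hR hP' hQi (hother P' hP' h) hQR' hQR hs⟩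
      · left
        rintro P' ⟨hP', hs⟩
        have h : P' ≠ P := by
          rintro rfl; exact hPR ⟨hP', hs⟩
        exact ⟨hP', region_transfer hg hR hR' hP' hQi (hother P' hP' h) hQR hQR' hs⟩
    · left
      push Not at hex
      rintro P' ⟨hP', hs⟩
      exact ⟨hP', region_transfer hg hR hR' hP' hQi (hex P' hP') hQR hQR' hs⟩
  · exfalso
    have hQf : Q ∈ frontier Γ.carrier := by
      rw [Γ.closed.frontier_eq]; exact ⟨hQcar, hQi⟩
    obtain ⟨i, hi⟩ := (Γ.mem_frontier_iff Q).1 hQf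
    obtain ⟨p, hp, q, hq, hpq, hpl, hql⟩ := hQF _ (Or.inl ⟨i, rfl⟩) hi
    have hpe : ∀ y ∈ Γ.edge i,
        crs (Γ.vertex (i + 1) - Γ.vertex i) (y - Γ.vertex i) = 0 := fun y hy =>
      segment_subset_line _ _ (by simp [crs]) (crs_self _) hy
    have hve : ∀ z, crs (Γ.vertex (i + 1) - Γ.vertex i) (z - Γ.vertex i) = 0 →
        crs (D - C) (z - C) = 0 := by
      intro z hz
      refine line_transfer hd hpq hpl hql ?_
      have hde : Γ.vertex (i + 1) - Γ.vertex i ≠ 0 := sub_ne_zero.2 (vertex_ne_succ i).symm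
      obtain ⟨a, ha⟩ := par hde (hpe p hp)
      obtain ⟨b, hb⟩ := par hde (hpe q hq)
      obtain ⟨c, hc⟩ := par hde hz
      rw [show q - p = (q - Γ.vertex i) - (p - Γ.vertex i) by abel,
        show z - p = (z - Γ.vertex i) - (p - Γ.vertex i) by abel, ha, hb, hc,
        ← sub_smul, ← sub_smul, crs_smul_left, crs_smul_right, crs_self]
      ring
    have h1 := hve (Γ.vertex i) (by simp [crs])
    have h2 := hve (Γ.vertex (i + 1)) (crs_self _)
    rw [hCQ] at h1 h2
    obtain ⟨r, hr, s, hs, hin, hout⟩ := Γ.edge_local hi hQv hd h1 h2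
    have hwev := finite_closed_avoid (windows_finite (Γ := Γ) hA) (by
      rintro w ⟨P, -, h⟩
      obtain ⟨a, b, rfl⟩ := window_seg h
      exact segment_closed a b) Q
    obtain ⟨r', hr', hwb⟩ := Metric.eventually_nhds_iff_ball.1 hwev
    set ρ := min r r' with hρ
    have hρ0 : 0 < ρ := lt_min hr hr'
    set H : Set Pt := {y | y ∈ Metric.ball Q ρ ∧ 0 < crs (s • (D - C)) (y - Q)} with hH
    have hHpre : IsPreconnected H := (convex_half _ _ _).isPreconnected
    have hHsub : H ⊆ interior Γ.carrier \ Γ.windows A := by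
      rintro y ⟨hy, hy0⟩
      rw [crs_smul_left] at hy0
      refine ⟨hin y (Metric.ball_subset_ball (min_le_left _ _) hy) hy0, ?_⟩
      rintro ⟨w, ⟨P, hP, hw⟩, hyw⟩
      have hQw := hwb y (Metric.ball_subset_ball (min_le_right _ _) hy) w ⟨P, hP, hw⟩ hyw
      obtain ⟨j, -, hj⟩ := window_line hw
      obtain ⟨p, hp, q, hq, hpq, hpl, hql⟩ := hQF w (Or.inr ⟨P, hP, hw⟩) hQw
      have := (window_line' hd hj hp hq hpq hpl hql).2.2 y hyw
      rw [hCQ] at this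
      rw [this] at hy0
      simp at hy0
    have hmeet : ∀ S ∈ Γ.regionInteriors A, Q ∈ closure S → H ⊆ S := by
      intro S hS hQS
      obtain ⟨y, hyb, hyS⟩ := mem_closure_iff.1 hQS _ Metric.isOpen_ball (Metric.mem_ball_self hρ0)
      obtain ⟨z, ⟨hzb, hzS⟩, hz⟩ := (line_compl_dense hd Q).inter_open_nonempty
        (Metric.ball Q ρ ∩ S) (Metric.isOpen_ball.inter (region_open hA hS)) ⟨y, hyb, hyS⟩
      have hz : crs (D - C) (z - Q) ≠ 0 := hz
      have hz0 : s * crs (D - C) (z - Q) ≠ 0 := mul_ne_zero hs hz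
      refine region_absorb hS hHpre hHsub hzS ⟨hzb, ?_⟩
      rw [crs_smul_left]
      rcases lt_or_gt_of_ne hz0 with h | h
      · exact absurd (mem_of_interior (region_sub hS hzS).1)
          (hout z (Metric.ball_subset_ball (min_le_left _ _) hzb) h)
      · exact h
    obtain ⟨v, hv⟩ := exists_crs_ne (smul_ne_zero hs hd)
    have hHne : H.Nonempty := by
      have key : ∀ v, 0 < crs (s • (D - C)) v → H.Nonempty := by
        intro v hv
        obtain ⟨δ, hδ, hsm⟩ := small_ball Q v hρ0
        refine ⟨Q + (δ / 2) • v, hsm _ (by rw [abs_of_pos (by linarith)]; linarith), ?_⟩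
        rw [add_sub_cancel_left, crs_smul_right]
        positivity
      rcases lt_or_gt_of_ne hv with h | h
      · exact key (-v) (by rw [crs_neg_right]; linarith)
      · exact key v h
    obtain ⟨y, hy⟩ := hHne
    exact hdisj y (hmeet R hR hQR hy) (hmeet R' hR' hQR' hy)

theorem Vset_finite {A : Set Pt} (hA : A.Finite) (R : Set Pt) : (Γ.Vset A R).Finite :=
  hA.subset (sep_subset _ _)

theorem main_forward {A : Set Pt} (hg : Γ.GP A) (hA : A.Finite) (h : ¬ Γ.NormalWrt A) :
    ∃ R : Set Pt, Γ.IsSink A R ∧ Γ.Covers (A \ Γ.Vset A R) (frontier Γ.carrier) := by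
  unfold NormalWrt at h
  push Not at h
  obtain ⟨F, hFA, hcov, hnot⟩ := h
  unfold Covers at hnot
  push Not at hnot
  obtain ⟨x, hx, hns⟩ := hnot
  have hxi : x ∈ interior Γ.carrier := by
    by_contra hn
    obtain ⟨G, hG, hs⟩ := hcov x (by rw [Γ.closed.frontier_eq]; exact ⟨hx, hn⟩)
    exact hns G hG hs
  have hev : ∀ᶠ y in nhds x, ∀ G ∈ F, ¬ Γ.Sees G y := by
    rw [Filter.eventually_all_finite (hA.subset hFA)]
    intro G hG
    exact (view_closed (Γ := Γ) G).isOpen_compl.mem_nhds (hns G hG)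
  obtain ⟨U, hU, hUo, hxU⟩ := mem_nhds_iff.1 hev
  obtain ⟨y, ⟨hyU, hyi⟩, hyw⟩ := (windows_dense (Γ := Γ) hA).inter_open_nonempty
    (U ∩ interior Γ.carrier) (hUo.inter isOpen_interior) ⟨x, hxU, hxi⟩
  set R0 := connectedComponentIn (interior Γ.carrier \ Γ.windows A) y with hR0
  have hyR0 : y ∈ R0 := mem_connectedComponentIn ⟨hyi, hyw⟩
  have hR0m : R0 ∈ Γ.regionInteriors A := ⟨y, ⟨hyi, hyw⟩, rfl⟩
  -- minimal region
  let good : Set (Set Pt) := {R | R ∈ Γ.regionInteriors A ∧ Γ.Vset A R ⊆ Γ.Vset A R0}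
  have hmin : ∃ R ∈ good, ∀ R' ∈ good, (Γ.Vset A R).ncard ≤ (Γ.Vset A R').ncard := by
    have hne : ((fun R => (Γ.Vset A R).ncard) '' good).Nonempty :=
      ⟨_, R0, ⟨hR0m, subset_rfl⟩, rfl⟩
    obtain ⟨R, hR, hRe⟩ := Nat.sInf_mem hne
    refine ⟨R, hR, fun R' hR' => ?_⟩
    have hRe : (Γ.Vset A R).ncard = _ := hRe
    rw [hRe]
    exact Nat.sInf_le ⟨R', hR', rfl⟩
  obtain ⟨R, ⟨hR, hRV⟩, hRmin⟩ := hmin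
  refine ⟨R, ⟨hR, ?_⟩, ?_⟩
  · intro R' hR' hadj
    rcases adjacent_comparable hg hA hR hR' hadj with h | h
    · exact h
    · have := hRmin R' ⟨hR', h.trans hRV⟩
      exact (Set.eq_of_subset_of_ncard_le h this (Vset_finite hA R)).symm.subset
  · intro b hb
    obtain ⟨G, hG, hs⟩ := hcov b hb
    refine ⟨G, ⟨hFA hG, fun hGV => ?_⟩, hs⟩
    exact hU hyU G hG ((hRV hGV).2 y hyR0)

theorem main_backward {A : Set Pt} (hg : Γ.GP A)
    (h : ∃ R : Set Pt, Γ.IsSink A R ∧ Γ.Covers (A \ Γ.Vset A R) (frontier Γ.carrier)) :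
    ¬ Γ.NormalWrt A := by
  obtain ⟨R, ⟨hR, -⟩, hcov⟩ := h
  intro hN
  obtain ⟨x, hx⟩ := region_nonempty hR
  obtain ⟨G, ⟨hG, hGV⟩, hs⟩ := hN _ sdiff_subset hcov x (mem_of_interior (region_sub hR hx).1)
  exact hGV ⟨hG, region_const hg hR hG hx hs⟩

end SimplePolygon

/-- a polygon is not normal with respect to a finite set `A` iff some sink
region `R` of the visibility decomposition has the property that the points of `A` not
seeing `R` cover the boundary. -/
theorem not_normalWrt_iff_sink (Γ : SimplePolygon) (A : Set Pt)
    (hA : A ⊆ Γ.carrier) (hAfin : A.Finite)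
    (hgen : ∀ x y z : Pt,
      x ∈ (Γ.vertex '' Set.univ) ∪ A → y ∈ (Γ.vertex '' Set.univ) ∪ A →
      z ∈ (Γ.vertex '' Set.univ) ∪ A → x ≠ y → x ≠ z → y ≠ z →
      ¬ Collinear ℝ ({x, y, z} : Set Pt)) :
    ¬ Γ.NormalWrt A ↔
      ∃ R : Set Pt, Γ.IsSink A R ∧
        Γ.Covers (A \ Γ.Vset A R) (frontier Γ.carrier) := by
  exact ⟨fun h => SimplePolygon.main_forward hgen hAfin h,
    fun h => SimplePolygon.main_backward hgen h⟩
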